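/- Let τ be an equicontinuous Köthe topology on E_K induced by F, and let g ∈ F. Then the set { fg : f ∈ K } is uniformly μ-integrable. -/

import Mathlib

open MeasureTheory Filter Topology Pointwise

noncomputable section

namespace EquicontKothe

variable {Ω : Type*} [MeasurableSpace Ω] (μ : Measure Ω) [IsProbabilityMeasure μ]

/-- Convergence in probability of a sequence in `L⁰(μ)`. -/
def TendstoInProb (f : ℕ → Ω →ₘ[μ] ℝ) (g : Ω →ₘ[μ] ℝ) : Prop :=
  TendstoInMeasure μ (fun n => ⇑(f n)) atTop ⇑g

/-- A set of elements of `L⁰(μ)` is closed in probability (stated sequentially, which is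
equivalent since the topology of convergence in probability is metrizable). -/
def ClosedInProb (C : Set (Ω →ₘ[μ] ℝ)) : Prop :=
  ∀ f : ℕ → Ω →ₘ[μ] ℝ, (∀ n, f n ∈ C) → ∀ g : Ω →ₘ[μ] ℝ, TendstoInProb μ f g → g ∈ C

/-- Boundedness in probability. -/
def BoundedInProb (C : Set (Ω →ₘ[μ] ℝ)) : Prop :=
  ∀ ε : ℝ, 0 < ε → ∃ δ : ℝ, 0 < δ ∧ ∀ f ∈ C, μ {ω | δ ≤ |f ω|} ≤ ENNReal.ofReal ε

/-- The polar of a set `C ⊆ L⁰(μ)`. -/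
def polar (C : Set (Ω →ₘ[μ] ℝ)) : Set (Ω →ₘ[μ] ℝ) :=
  {g | ∀ f ∈ C, ∫⁻ ω, (‖f ω * g ω‖₊ : ENNReal) ∂μ ≤ 1}

/-- `E_K`, the span of `K`. -/
def EK (K : Set (Ω →ₘ[μ] ℝ)) : Submodule ℝ (Ω →ₘ[μ] ℝ) := Submodule.span ℝ K

/-- `E'_K`, the span of the polar of `K`. -/
def EK' (K : Set (Ω →ₘ[μ] ℝ)) : Submodule ℝ (Ω →ₘ[μ] ℝ) := Submodule.span ℝ (polar μ K)

/-- The pairing `(f, g) ↦ ∫ fg dμ`. -/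
def pair (f g : Ω →ₘ[μ] ℝ) : ℝ := ∫ ω, f ω * g ω ∂μ

/-- A set `F ⊆ L⁰(μ)` is solid. -/
def SolidSet (F : Set (Ω →ₘ[μ] ℝ)) : Prop :=
  ∀ g ∈ F, ∀ h : Ω →ₘ[μ] ℝ, (∀ᵐ ω ∂μ, |h ω| ≤ |g ω|) → h ∈ F

/-- A set `F ⊆ L⁰(μ)` is a linear subspace. -/
def IsSubspace (F : Set (Ω →ₘ[μ] ℝ)) : Prop :=
  (0 : Ω →ₘ[μ] ℝ) ∈ F ∧ (∀ g ∈ F, ∀ h ∈ F, g + h ∈ F) ∧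
    ∀ (a : ℝ) (g : Ω →ₘ[μ] ℝ), g ∈ F → a • g ∈ F

/-- `g` is strictly positive, i.e. `g > 0` a.e. -/
def StrictlyPos (g : Ω →ₘ[μ] ℝ) : Prop := ∀ᵐ ω ∂μ, 0 < g ω

/-- `F` separates the points of the subspace `E` via the pairing `(f,g) ↦ ∫ fg dμ`. -/
def Separates (F : Set (Ω →ₘ[μ] ℝ)) (E : Submodule ℝ (Ω →ₘ[μ] ℝ)) : Prop :=
  ∀ f ∈ E, f ≠ 0 → ∃ g ∈ F, pair μ f g ≠ 0

/-- The weak topology `σ(E, F)` on a subspace `E ⊆ L⁰(μ)` induced by the pairing with `F`. -/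
def weakTop (E : Submodule ℝ (Ω →ₘ[μ] ℝ)) (F : Set (Ω →ₘ[μ] ℝ)) : TopologicalSpace E :=
  ⨅ g ∈ F, TopologicalSpace.induced (fun f : E => pair μ (f : Ω →ₘ[μ] ℝ) g) inferInstance

/-- A set `A ⊆ E_K` is `K`-bounded if it is contained in some positive multiple of `K`. -/
def KBdd (K : Set (Ω →ₘ[μ] ℝ)) (A : Set (EK μ K)) : Prop :=
  ∃ c : ℝ, 0 < c ∧ ∀ f ∈ A, ((f : Ω →ₘ[μ] ℝ)) ∈ c • K

/-- `τ` is an equicontinuous Köthe topology on `E_K` induced by `F`. -/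
def IsEquicontKothe (K : Set (Ω →ₘ[μ] ℝ)) (τ : TopologicalSpace (EK μ K))
    (F : Set (Ω →ₘ[μ] ℝ)) : Prop :=
  @IsCompact _ τ {f : EK μ K | (f : Ω →ₘ[μ] ℝ) ∈ K} ∧
  F ⊆ (EK' μ K : Set (Ω →ₘ[μ] ℝ)) ∧
  IsSubspace μ F ∧
  SolidSet μ F ∧
  (∃ g ∈ F, StrictlyPos μ g) ∧
  Separates μ F (EK μ K) ∧
  ∀ A : Set (EK μ K), KBdd μ K A →
    TopologicalSpace.induced (Subtype.val : A → EK μ K) τ =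
      TopologicalSpace.induced (Subtype.val : A → EK μ K) (weakTop μ (EK μ K) F)

/-- `τ` has the Krein-Šmulian property. -/
def KreinSmulian (K : Set (Ω →ₘ[μ] ℝ)) (τ : TopologicalSpace (EK μ K)) : Prop :=
  ∀ C : Set (EK μ K), Convex ℝ C →
    (@IsClosed _ τ C ↔ ∀ c : ℝ, 0 < c → @IsClosed _ τ (C ∩ {f | (f : Ω →ₘ[μ] ℝ) ∈ c • K}))

/-- Convexity for extended-real-valued functions. -/
def ConvexFn {E : Type*} [AddCommMonoid E] [Module ℝ E] (φ : E → EReal) : Prop :=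
  ∀ f g : E, ∀ a b : ℝ, 0 ≤ a → 0 ≤ b → a + b = 1 →
    φ (a • f + b • g) ≤ (a : EReal) * φ f + (b : EReal) * φ g

/-- Properness: `φ` takes values in `(-∞, ∞]` and is not identically `∞`. -/
def ProperFn {E : Type*} (φ : E → EReal) : Prop :=
  (∀ f, φ f ≠ ⊥) ∧ ∃ f, φ f ≠ ⊤

/-- The equicontinuous Fatou property. -/
def EquicontFatou (K : Set (Ω →ₘ[μ] ℝ)) (φ : EK μ K → EReal) : Prop :=
  ∀ (f : ℕ → EK μ K) (g : EK μ K),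
    (∃ c : ℝ, 0 < c ∧ ∀ n, ((f n : Ω →ₘ[μ] ℝ)) ∈ c • K) →
    TendstoInProb μ (fun n => ((f n : Ω →ₘ[μ] ℝ))) (g : Ω →ₘ[μ] ℝ) →
    φ g ≤ liminf (fun n => φ (f n)) atTop

/-- `τ` is `F`-regular: every `τ`-continuous linear functional is represented by some `g ∈ F`. -/
def FRegular (K : Set (Ω →ₘ[μ] ℝ)) (τ : TopologicalSpace (EK μ K))
    (F : Set (Ω →ₘ[μ] ℝ)) : Prop :=
  ∀ T : EK μ K →ₗ[ℝ] ℝ, @Continuous _ _ τ _ T →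
    ∃ g ∈ F, ∀ f : EK μ K, T f = pair μ (f : Ω →ₘ[μ] ℝ) g

/-- The conjugate `φ*` of `φ` at `g`. -/
def phiStar (K : Set (Ω →ₘ[μ] ℝ)) (φ : EK μ K → EReal) (g : Ω →ₘ[μ] ℝ) : EReal :=
  ⨆ h : EK μ K, ((pair μ (h : Ω →ₘ[μ] ℝ) g : ℝ) : EReal) - φ h

/-- The solid hull of `K`. -/
def solidHull (K : Set (Ω →ₘ[μ] ℝ)) : Set (Ω →ₘ[μ] ℝ) :=
  {f | ∃ g ∈ K, ∀ᵐ ω ∂μ, |f ω| ≤ |g ω|}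

/-- `S` is uniformly `ν`-integrable. -/
def UnifInt (ν : Measure Ω) (S : Set (Ω →ₘ[μ] ℝ)) : Prop :=
  (∀ ε : ℝ, 0 < ε → ∃ δ : ℝ, 0 < δ ∧ ∀ A : Set Ω, MeasurableSet A →
      ν A < ENNReal.ofReal δ →
      ∀ f ∈ S, ∫⁻ ω in A, (‖f ω‖₊ : ENNReal) ∂ν < ENNReal.ofReal ε) ∧
  ∃ C : ℝ, ∀ f ∈ S, ∫⁻ ω, (‖f ω‖₊ : ENNReal) ∂ν ≤ ENNReal.ofReal C

/-- `μ` is non-atomic. -/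
def Nonatomic : Prop :=
  ∀ A : Set Ω, MeasurableSet A → 0 < μ A →
    ∃ B : Set Ω, MeasurableSet B ∧ B ⊆ A ∧ 0 < μ B ∧ μ B < μ A

/-- Increasing with respect to the μ-a.e. order. -/
def MonoInc {E : Submodule ℝ (Ω →ₘ[μ] ℝ)} (φ : E → EReal) : Prop :=
  ∀ f h : E, (∀ᵐ ω ∂μ, (f : Ω →ₘ[μ] ℝ) ω ≤ (h : Ω →ₘ[μ] ℝ) ω) → φ f ≤ φ h

/-- Decreasing with respect to the μ-a.e. order. -/
def MonoDec {E : Submodule ℝ (Ω →ₘ[μ] ℝ)} (φ : E → EReal) : Prop :=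
  ∀ f h : E, (∀ᵐ ω ∂μ, (f : Ω →ₘ[μ] ℝ) ω ≤ (h : Ω →ₘ[μ] ℝ) ω) → φ h ≤ φ f

/-- The `F`-positive Hahn-Banach property of `E_K`. -/
def PosHB (K : Set (Ω →ₘ[μ] ℝ)) (F : Set (Ω →ₘ[μ] ℝ)) : Prop :=
  ∀ T : EK μ K →ₗ[ℝ] ℝ,
    @Continuous _ _ (weakTop μ (EK μ K) F) _ T →
    (∀ f : EK μ K, (∀ᵐ ω ∂μ, 0 ≤ (f : Ω →ₘ[μ] ℝ) ω) → 0 ≤ T f) →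
    ∃ S : EK μ (solidHull μ K) →ₗ[ℝ] ℝ,
      @Continuous _ _ (weakTop μ (EK μ (solidHull μ K)) F) _ S ∧
      (∀ f : EK μ (solidHull μ K), (∀ᵐ ω ∂μ, 0 ≤ (f : Ω →ₘ[μ] ℝ) ω) → 0 ≤ S f) ∧
      ∀ (f : Ω →ₘ[μ] ℝ) (hf : f ∈ EK μ K) (hf' : f ∈ EK μ (solidHull μ K)),
        S ⟨f, hf'⟩ = T ⟨f, hf⟩


/-- **Phillips' lemma.** If `c k` are summable sequences whose sums over every set of indices
tend to zero as `k → ∞`, then the diagonal entries along `φ → ∞` tend to zero. -/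
theorem eventually_abs_apply_le_of_tendsto_tsum {c : ℕ → ℕ → ℝ} (hc : ∀ k, Summable (c k))
    (hlim : ∀ x : ℕ → Bool, Tendsto (fun k => ∑' j, if x j then c k j else 0) atTop (𝓝 0))
    {φ : ℕ → ℕ} (hφ : Tendsto φ atTop atTop) {ε : ℝ} (hε : 0 < ε) :
    ∀ᶠ k in atTop, |c k (φ k)| ≤ ε := by
  have hcont : ∀ k, Continuous fun x : ℕ → Bool => ∑' j, if x j then c k j else 0 := by
    intro k
    refine continuous_tsum (u := fun j => |c k j|) (fun j => ?_) (hc k).abs fun j x => ?_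
    · exact (continuous_of_discreteTopology (f := fun b : Bool => if b then c k j else 0)).comp
        (continuous_apply j)
    · by_cases hx : x j <;> simp [hx]
  let V : ℕ → Set (ℕ → Bool) := fun N =>
    ⋂ k ≥ N, {x | |∑' j, if x j then c k j else 0| ≤ ε / 2}
  have hV : ∀ N, IsClosed (V N) := fun N =>
    isClosed_biInter fun k _ => isClosed_le (hcont k).abs continuous_const
  have hU : ⋃ N, V N = Set.univ := by
    refine Set.eq_univ_of_forall fun x => ?_
    have h := (hlim x).abs
    rw [abs_zero] at h
    obtain ⟨N, hN⟩ := eventually_atTop.1 (h.eventually_le_const (half_pos hε))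
    exact Set.mem_iUnion.2 ⟨N, Set.mem_iInter₂.2 hN⟩
  obtain ⟨N, x₀, hx₀⟩ := nonempty_interior_of_iUnion_of_closed hV hU
  have hup : ∀ b : Bool, ∀ᶠ j in atTop, Function.update x₀ j b ∈ V N := by
    intro b
    have ht : Tendsto (fun j => Function.update x₀ j b) atTop (𝓝 x₀) := by
      refine tendsto_pi_nhds.2 fun i => tendsto_const_nhds.congr' ?_
      filter_upwards [eventually_gt_atTop i] with j hj
      rw [Function.update_of_ne hj.ne]
    filter_upwards [ht.eventually (isOpen_interior.mem_nhds hx₀)] with j hj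
    exact interior_subset hj
  filter_upwards [hφ.eventually (hup true), hφ.eventually (hup false), eventually_ge_atTop N]
    with k ht hf hk
  have ht := Set.mem_iInter₂.1 ht k hk
  have hf := Set.mem_iInter₂.1 hf k hk
  simp only [Set.mem_ofPred_eq] at ht hf
  have hs : ∀ x : ℕ → Bool, Summable fun j => if x j then c k j else 0 := fun x =>
    .of_norm_bounded (hc k).abs fun j => by by_cases hx : x j <;> simp [hx]
  have key : (∑' j, if Function.update x₀ (φ k) true j then c k j else 0)
      - (∑' j, if Function.update x₀ (φ k) false j then c k j else 0) = c k (φ k) := by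
    rw [← (hs _).tsum_sub (hs _), tsum_eq_single (φ k)]
    · simp
    · intro j hj
      simp [Function.update_of_ne hj]
  rw [← key]
  linarith [abs_sub _ _ |>.trans (add_le_add ht hf)]

/-- A compact family of summable sequences, for a topology making the sum over every set of
indices continuous, has no sequence whose diagonal entries stay away from zero. -/
theorem not_forall_le_abs_diagonal {X : Type*} [TopologicalSpace X] [CompactSpace X]
    {a : X → ℕ → ℝ} (ha : ∀ f, Summable (a f))
    (hcont : ∀ x : ℕ → Bool, Continuous fun f => ∑' j, if x j then a f j else 0)
    (f : ℕ → X) {ε : ℝ} (hε : 0 < ε) : ¬ ∀ n, ε ≤ |a (f n) n| := by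
  intro hf
  have hac : Continuous a := by
    refine continuous_pi fun j => (hcont fun i => decide (i = j)).congr fun f => ?_
    rw [tsum_eq_single j fun i hi => by simp [hi]]
    simp
  let b : X → Set.range a := Set.rangeFactorization a
  have hb : IsQuotientMap b :=
    .of_surjective_continuous Set.rangeFactorization_surjective (hac.subtype_mk _)
  have hsum : ∀ x : ℕ → Bool,
      Continuous fun s : Set.range a => ∑' j, if x j then (s : ℕ → ℝ) j else 0 := fun x =>
    hb.continuous_iff.2 (hcont x)
  obtain ⟨_, ⟨g, rfl⟩, φ, hφ, hlim⟩ :=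
    (isCompact_range hac).isSeqCompact (x := fun n => a (f n)) fun n => Set.mem_range_self _
  have hlim' : Tendsto (fun k => b (f (φ k))) atTop (𝓝 (b g)) :=
    tendsto_subtype_rng.2 hlim
  have hs : ∀ (x : ℕ → Bool) (h : X), Summable fun j => if x j then a h j else 0 := fun x h =>
    .of_norm_bounded (ha h).abs fun j => by by_cases hx : x j <;> simp [hx]
  have hev := eventually_abs_apply_le_of_tendsto_tsum
    (c := fun k j => a (f (φ k)) j - a g j) (fun k => (ha _).sub (ha _)) (fun x => ?_)
    hφ.tendsto_atTop (ε := ε / 4) (by positivity)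
  · have hg := ((ha g).tendsto_atTop_zero.comp hφ.tendsto_atTop).abs
    rw [abs_zero] at hg
    obtain ⟨k, hk, hk'⟩ := (hev.and (hg.eventually_le_const (show 0 < ε / 4 by positivity))).exists
    have h1 := hf (φ k)
    have h2 := abs_sub_abs_le_abs_sub (a (f (φ k)) (φ k)) (a g (φ k))
    simp only [Function.comp_apply] at hk'
    linarith
  · have h := ((hsum x).tendsto (b g)).comp hlim'
    refine (sub_self (∑' j, if x j then a g j else 0) ▸ h.sub_const _).congr fun k => ?_
    change (∑' j, if x j then a (f (φ k)) j else 0) - _ = _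
    rw [← (hs x _).tsum_sub (hs x _)]
    refine tsum_congr fun j => ?_
    split_ifs <;> simp

omit [IsProbabilityMeasure μ] in
theorem exists_measurableSet_half_le_abs_setIntegral {u : Ω → ℝ} (hm : Measurable u)
    (hi : Integrable u μ) {A : Set Ω} (hA : MeasurableSet A) {ε : ℝ}
    (h : ENNReal.ofReal ε ≤ ∫⁻ ω in A, (‖u ω‖₊ : ENNReal) ∂μ) :
    ∃ B ⊆ A, MeasurableSet B ∧ ε / 2 ≤ |∫ ω in B, u ω ∂μ| := by
  have hP : MeasurableSet {ω | 0 ≤ u ω} := measurableSet_le measurable_const hm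
  have h' : ε ≤ ∫ ω in A, |u ω| ∂μ := by
    have := ofReal_integral_norm_eq_lintegral_enorm (hi.integrableOn (s := A))
    simp only [Real.norm_eq_abs] at this
    rw [← ENNReal.ofReal_le_ofReal_iff (integral_nonneg fun _ => abs_nonneg _), this]
    exact h
  have hsplit := integral_inter_add_sdiff (s := A) (f := fun ω => |u ω|) hP hi.abs.integrableOn
  have hp : ∫ ω in A ∩ {ω | 0 ≤ u ω}, |u ω| ∂μ = ∫ ω in A ∩ {ω | 0 ≤ u ω}, u ω ∂μ :=
    setIntegral_congr_fun (hA.inter hP) fun ω hω => abs_of_nonneg hω.2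
  have hn : ∫ ω in A \ {ω | 0 ≤ u ω}, |u ω| ∂μ = -∫ ω in A \ {ω | 0 ≤ u ω}, u ω ∂μ := by
    rw [← integral_neg]
    exact setIntegral_congr_fun (hA.diff hP) fun ω hω => abs_of_neg (not_le.1 hω.2)
  by_cases hc : ε / 2 ≤ |∫ ω in A ∩ {ω | 0 ≤ u ω}, u ω ∂μ|
  · exact ⟨_, Set.inter_subset_left, hA.inter hP, hc⟩
  · refine ⟨_, Set.sdiff_subset, hA.diff hP, ?_⟩
    have h1 := le_abs_self (∫ ω in A ∩ {ω | 0 ≤ u ω}, u ω ∂μ)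
    have h2 := neg_le_abs (∫ ω in A \ {ω | 0 ≤ u ω}, u ω ∂μ)
    linarith

omit [IsProbabilityMeasure μ] in
/-- A family of integrable functions that is not equi-absolutely continuous carries mass bounded
below on a sequence of pairwise disjoint sets. -/
theorem exists_pairwise_disjoint_le_abs_setIntegral {U : Set (Ω → ℝ)}
    (hU : ∀ u ∈ U, Integrable u μ) {ε : ℝ} (hε : 0 < ε)
    (h : ∀ δ : ENNReal, 0 < δ → ∃ u ∈ U, ∃ A, MeasurableSet A ∧ μ A < δ ∧
      ε ≤ |∫ ω in A, u ω ∂μ|) :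
    ∃ (u : ℕ → Ω → ℝ) (B : ℕ → Set Ω), (∀ n, u n ∈ U) ∧ (∀ n, MeasurableSet (B n)) ∧
      Pairwise (Function.onFun Disjoint B) ∧ ∀ n, ε / 2 ≤ |∫ ω in B n, u n ω ∂μ| := by
  have hac : ∀ u ∈ U, ∃ d : ENNReal, 0 < d ∧
      ∀ s, μ s ≤ d → |∫ ω in s, u ω ∂μ| ≤ ε / 2 := by
    intro u hu
    obtain ⟨d, hd, hs⟩ := exists_pos_setLIntegral_lt_of_measure_lt (hU u hu).2.ne
      (ENNReal.ofReal_pos.2 (half_pos hε)).ne'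
    obtain ⟨d', hd', hd'd⟩ := exists_between hd
    refine ⟨d', hd', fun s hms => ?_⟩
    rw [← Real.norm_eq_abs, ← ENNReal.ofReal_le_ofReal_iff (half_pos hε).le,
      ofReal_norm]
    exact (enorm_integral_le_lintegral_enorm _).trans (hs s (hms.trans_lt hd'd)).le
  have step : ∀ δ : Set.Ioi (0 : ENNReal), ∃ (u : Ω → ℝ) (A : Set Ω) (d : ENNReal), u ∈ U ∧
      MeasurableSet A ∧ μ A < δ ∧ ε ≤ |∫ ω in A, u ω ∂μ| ∧ 0 < d ∧
      ∀ s, μ s ≤ d → |∫ ω in s, u ω ∂μ| ≤ ε / 2 := by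
    rintro ⟨δ, hδ⟩
    obtain ⟨u, hu, A, hA, hAδ, hAε⟩ := h δ hδ
    obtain ⟨d, hd, hs⟩ := hac u hu
    exact ⟨u, A, d, hu, hA, hAδ, hAε, hd, hs⟩
  choose u A d hu hA hAδ hAε hd hs using step
  let next : Set.Ioi (0 : ENNReal) → Set.Ioi (0 : ENNReal) := fun δ =>
    ⟨min (δ : ENNReal) (d δ) / 2, ENNReal.half_pos (lt_min δ.2 (hd δ)).ne'⟩
  let η : ℕ → Set.Ioi (0 : ENNReal) := fun n => next^[n] ⟨1, Set.mem_Ioi.2 one_pos⟩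
  have hη : ∀ n, (η (n + 1) : ENNReal) = min (η n : ENNReal) (d (η n)) / 2 := fun n => by
    simp only [η, Function.iterate_succ_apply', next]
  have hgeom : ∀ n k, (η (n + 1 + k) : ENNReal) ≤ d (η n) * 2⁻¹ ^ (k + 1) := by
    intro n k
    induction k with
    | zero =>
      rw [add_zero, hη, zero_add, pow_one, ENNReal.div_eq_inv_mul, mul_comm]
      gcongr
      exact min_le_right _ _
    | succ k ih =>
      rw [← add_assoc, hη, pow_succ, ← mul_assoc, ENNReal.div_eq_inv_mul, mul_comm]
      gcongr
      exact (min_le_left _ _).trans ih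
  let R : ℕ → Set Ω := fun n => ⋃ k, A (η (n + 1 + k))
  have hRm : ∀ n, MeasurableSet (R n) := fun n => .iUnion fun k => hA _
  have hR : ∀ n, μ (R n) ≤ d (η n) := fun n => calc
    μ (R n) ≤ ∑' k, μ (A (η (n + 1 + k))) := measure_iUnion_le _
    _ ≤ ∑' k, d (η n) * 2⁻¹ ^ (k + 1) :=
      ENNReal.tsum_le_tsum fun k => (hAδ _).le.trans (hgeom n k)
    _ = d (η n) := by
      rw [ENNReal.tsum_mul_left, ENNReal.tsum_geometric_add_one, ENNReal.one_sub_inv_two, inv_inv,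
        ENNReal.inv_mul_cancel two_ne_zero ENNReal.ofNat_ne_top, mul_one]
  have hdisj : ∀ m n, m < n → Disjoint (A (η m) \ R m) (A (η n) \ R n) := by
    intro m n hmn
    refine Set.disjoint_left.2 fun ω hm hn => hm.2 (Set.mem_iUnion.2 ⟨n - (m + 1), ?_⟩)
    rw [Nat.add_sub_cancel' hmn]
    exact hn.1
  refine ⟨fun n => u (η n), fun n => A (η n) \ R n, fun n => hu _, fun n => (hA _).diff (hRm n),
    fun m n hmn => ?_, fun n => ?_⟩
  · exact hmn.lt_or_gt.elim (hdisj m n) fun h => (hdisj n m h).symm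
  · have hsplit := integral_inter_add_sdiff (s := A (η n)) (hRm n) (hU _ (hu (η n))).integrableOn
    have h1 := hs (η n) _ ((measure_mono (Set.inter_subset_right (s := A (η n)))).trans (hR n))
    have h2 := hAε (η n)
    rw [← hsplit] at h2
    linarith [abs_add_le (∫ ω in A (η n) ∩ R n, u (η n) ω ∂μ)
      (∫ ω in A (η n) \ R n, u (η n) ω ∂μ)]

omit [IsProbabilityMeasure μ] in
theorem exists_lintegral_le_of_mem_EK' {K : Set (Ω →ₘ[μ] ℝ)} {g : Ω →ₘ[μ] ℝ} (hg : g ∈ EK' μ K) :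
    ∃ C : ℝ, 0 ≤ C ∧
      ∀ f ∈ K, ∫⁻ ω, (‖f ω * g ω‖₊ : ENNReal) ∂μ ≤ ENNReal.ofReal C := by
  induction hg using Submodule.span_induction with
  | mem g hg => exact ⟨1, zero_le_one, fun f hf => by simpa using hg f hf⟩
  | zero =>
    refine ⟨0, le_rfl, fun f _ => ?_⟩
    rw [ENNReal.ofReal_zero, nonpos_iff_eq_zero, lintegral_eq_zero_iff' (by fun_prop)]
    filter_upwards [AEEqFun.coeFn_zero (α := Ω) (β := ℝ) (μ := μ)] with ω h
    simp [h]
  | add g₁ g₂ _ _ h₁ h₂ =>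
    obtain ⟨C₁, hC₁, h₁⟩ := h₁
    obtain ⟨C₂, hC₂, h₂⟩ := h₂
    refine ⟨C₁ + C₂, add_nonneg hC₁ hC₂, fun f hf => ?_⟩
    rw [ENNReal.ofReal_add hC₁ hC₂]
    refine le_trans ?_ (add_le_add (h₁ f hf) (h₂ f hf))
    rw [← lintegral_add_left' (by fun_prop)]
    refine lintegral_mono_ae ?_
    filter_upwards [AEEqFun.coeFn_add g₁ g₂] with ω h
    rw [h, Pi.add_apply, mul_add]
    exact_mod_cast nnnorm_add_le _ _
  | smul c g _ h =>
    obtain ⟨C, hC, h⟩ := h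
    refine ⟨|c| * C, mul_nonneg (abs_nonneg c) hC, fun f hf => ?_⟩
    rw [ENNReal.ofReal_mul (abs_nonneg c)]
    refine le_trans ?_ (mul_le_mul_right (h f hf) _)
    rw [← lintegral_const_mul'' _ (by fun_prop)]
    refine lintegral_mono_ae ?_
    filter_upwards [AEEqFun.coeFn_smul c g] with ω h
    rw [h, Pi.smul_apply, smul_eq_mul, mul_left_comm, nnnorm_mul, ENNReal.coe_mul,
      ← Real.norm_eq_abs, ofReal_norm]
    rfl

omit [IsProbabilityMeasure μ] in
theorem continuous_pair_weakTop (E : Submodule ℝ (Ω →ₘ[μ] ℝ)) {F : Set (Ω →ₘ[μ] ℝ)}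
    {h : Ω →ₘ[μ] ℝ} (hh : h ∈ F) :
    Continuous[weakTop μ E F, inferInstance] fun f : E => pair μ (f : Ω →ₘ[μ] ℝ) h :=
  continuous_iInf_dom (i := h) (continuous_iInf_dom (i := hh) continuous_induced_dom)

omit [IsProbabilityMeasure μ] in
theorem pair_mk_indicator {f g : Ω →ₘ[μ] ℝ} {A : Set Ω} (hA : MeasurableSet A)
    (hm : AEStronglyMeasurable (A.indicator g) μ) :
    pair μ f (AEEqFun.mk (A.indicator g) hm) = ∫ ω in A, f ω * g ω ∂μ := by
  rw [pair, ← integral_indicator hA]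
  refine integral_congr_ae ?_
  filter_upwards [AEEqFun.coeFn_mk _ hm] with ω h
  by_cases hω : ω ∈ A <;> simp [h, hω]

omit [IsProbabilityMeasure μ] in
/-- An equicontinuous Köthe topology induced by `F` gives a compact topology on `K` for which
`f ↦ ∫_A fg dμ` is continuous for every `g ∈ F` and every measurable set `A`. -/
theorem IsEquicontKothe.exists_compactSpace {K : Set (Ω →ₘ[μ] ℝ)} {τ : TopologicalSpace (EK μ K)}
    {F : Set (Ω →ₘ[μ] ℝ)} (hτ : IsEquicontKothe μ K τ F) :
    ∃ _ : TopologicalSpace K, CompactSpace K ∧ ∀ g ∈ F, ∀ A : Set Ω, MeasurableSet A →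
      Continuous fun f : K => ∫ ω in A, (f : Ω →ₘ[μ] ℝ) ω * g ω ∂μ := by
  obtain ⟨hcomp, -, -, hsolid, -, -, hagree⟩ := hτ
  let S : Set (EK μ K) := {f | (f : Ω →ₘ[μ] ℝ) ∈ K}
  have hS : KBdd μ K S := ⟨1, one_pos, fun f hf => by rwa [one_smul]⟩
  let e : K → S := fun f => ⟨⟨f, Submodule.subset_span f.2⟩, f.2⟩
  let e' : S → K := fun f => ⟨f, f.2⟩
  let tS : TopologicalSpace S := .induced Subtype.val τ
  have : CompactSpace S := isCompact_iff_compactSpace.1 hcomp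
  refine ⟨.induced e tS, ?_, fun g hg A hA => ?_⟩
  · let t : TopologicalSpace K := .induced e tS
    have he' : Continuous e' := continuous_induced_rng.2 continuous_id
    have hsurj : Function.Surjective e' := fun f => ⟨e f, rfl⟩
    exact hsurj.compactSpace he'
  · have hm : AEStronglyMeasurable (A.indicator g) μ := g.aestronglyMeasurable.indicator hA
    have hmem : AEEqFun.mk (A.indicator g) hm ∈ F := by
      refine hsolid g hg _ ?_
      filter_upwards [AEEqFun.coeFn_mk _ hm] with ω h
      by_cases hω : ω ∈ A <;> simp [h, hω]
    have hS' : Continuous[tS, inferInstance]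
        fun f : S => pair μ (f : EK μ K) (AEEqFun.mk (A.indicator g) hm) := by
      rw [show tS = _ from hagree S hS]
      exact @Continuous.comp _ _ _ (.induced _ (weakTop μ (EK μ K) F)) (weakTop μ (EK μ K) F) _ _ _
        (continuous_pair_weakTop μ (EK μ K) hmem) continuous_induced_dom
    let t : TopologicalSpace K := .induced e tS
    have he : Continuous e := continuous_induced_dom
    exact (hS'.comp he).congr fun f => pair_mk_indicator μ hA hm

section Theorems

variable (K : Set (Ω →ₘ[μ] ℝ))

theorem stmt8
    (hconv : Convex ℝ K) (hbal : Balanced ℝ K)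
    (hcl : ClosedInProb μ K) (hbdd : BoundedInProb μ K)
    (τ : TopologicalSpace (EK μ K)) (F : Set (Ω →ₘ[μ] ℝ))
    (hτ : IsEquicontKothe μ K τ F)
    (g : Ω →ₘ[μ] ℝ) (hg : g ∈ F) :
    UnifInt μ μ ((fun f => f * g) '' K) := by
  obtain ⟨C, -, hC⟩ := exists_lintegral_le_of_mem_EK' μ (hτ.2.1 hg)
  have hprod : ∀ (f : Ω →ₘ[μ] ℝ) (A : Set Ω), ∫⁻ ω in A, (‖(f * g) ω‖₊ : ENNReal) ∂μ =
      ∫⁻ ω in A, (‖f ω * g ω‖₊ : ENNReal) ∂μ := fun f A => by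
    refine lintegral_congr_ae (ae_restrict_of_ae ?_)
    filter_upwards [AEEqFun.coeFn_mul f g] with ω h
    rw [h, Pi.mul_apply]
  have hint : ∀ f ∈ K, Integrable (fun ω => f ω * g ω) μ := fun f hf =>
    ⟨f.aestronglyMeasurable.mul g.aestronglyMeasurable, (hC f hf).trans_lt ENNReal.ofReal_lt_top⟩
  refine ⟨fun ε hε => ?_, C, ?_⟩
  · by_contra! hcon
    obtain ⟨t, hcpt, hcont⟩ := hτ.exists_compactSpace μ
    obtain ⟨u, B, hu, hB, hdisj, hBε⟩ := exists_pairwise_disjoint_le_abs_setIntegral μ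
      (U := (fun f ω => f ω * g ω) '' K) (Set.forall_mem_image.2 hint) (half_pos hε) fun δ hδ => by
        have hδ' : 0 < (min δ 1).toReal :=
          ENNReal.toReal_pos (lt_min hδ one_pos).ne' (min_lt_of_right_lt ENNReal.one_lt_top).ne
        obtain ⟨A, hA, hAδ, _, ⟨f, hf, rfl⟩, hfA⟩ := hcon _ hδ'
        rw [ENNReal.ofReal_toReal (min_lt_of_right_lt ENNReal.one_lt_top).ne] at hAδ
        rw [hprod] at hfA
        obtain ⟨B, hBA, hB, hBε⟩ := exists_measurableSet_half_le_abs_setIntegral μ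
          (f.measurable.mul g.measurable) (hint f hf) hA hfA
        exact ⟨_, Set.mem_image_of_mem _ hf, B, hB,
          ((measure_mono hBA).trans_lt hAδ).trans_le (min_le_left _ _), hBε⟩
    choose f hf hfu using hu
    refine not_forall_le_abs_diagonal
      (a := fun (f : K) j => ∫ ω in B j, (f : Ω →ₘ[μ] ℝ) ω * g ω ∂μ)
      (fun f => (hasSum_integral_iUnion hB hdisj (hint f f.2).integrableOn).summable)
      (fun x => ?_) (fun n => ⟨f n, hf n⟩) (half_pos (half_pos hε)) fun n => ?_
    · have hBx : ∀ j, MeasurableSet (if x j then B j else ∅) := fun j => by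
        split_ifs
        exacts [hB j, .empty]
      refine (hcont g hg _ (MeasurableSet.iUnion hBx)).congr fun f => ?_
      rw [integral_iUnion hBx (fun i j hij => (hdisj hij).mono ?_ ?_) (hint f f.2).integrableOn]
      · refine tsum_congr fun j => ?_
        split_ifs <;> simp
      all_goals
        dsimp only
        split_ifs
        exacts [le_rfl, Set.empty_subset _]
    · have h := hBε n
      rw [← hfu n] at h
      exact h
  · rintro _ ⟨f, hf, rfl⟩
    simpa only [Measure.restrict_univ] using (hprod f Set.univ).trans_le
      ((setLIntegral_le_lintegral _ _).trans (hC f hf))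

end Theorems

end EquicontKothe
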